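/- arXiv:2511.21493 — 3 statements merged into one kernel-verified Lean document; each statement's English description precedes it below -/
import Mathlib

section
/- Generalized Fourier identity, simplest (K5) instance: Let p₁, p₂ ∈ ℝ⁴ (Euclidean momenta) be linearly independent and set q = -p₁ - p₂. Let z ∈ ℂ with Im z ≠ 0 satisfy z·z̄ = ‖p₁‖²/‖q‖² and (1-z)(1-z̄) = ‖p₂‖²/‖q‖², where z̄ is the complex conjugate of z. Let e = (1,0,0,0) ∈ ℝ⁴ and u = (Re z, Im z, 0, 0) ∈ ℝ⁴. Then both integrands below are Lebesgue integrable on ℝ⁴ and the momentum-space one-loop triangle integral equals 1/‖q‖² times the position-space one-loop integral: ∫_{ℝ⁴} dl / (‖l‖² ‖l+p₁‖² ‖l-q‖²) = (1/‖q‖²) · ∫_{ℝ⁴} dx / (‖x‖² ‖x-e‖² ‖x-u‖²). -/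
open MeasureTheory

/-- The point `(1,0,0,0)` in Euclidean `ℝ⁴`. -/
noncomputable def e4 : EuclideanSpace ℝ (Fin 4) :=
  (WithLp.equiv 2 (Fin 4 → ℝ)).symm ![1, 0, 0, 0]

/-- The embedding `(Re z, Im z, 0, 0)` of `z ∈ ℂ` into Euclidean `ℝ⁴`. -/
noncomputable def uOf (z : ℂ) : EuclideanSpace ℝ (Fin 4) :=
  (WithLp.equiv 2 (Fin 4 → ℝ)).symm ![z.re, z.im, 0, 0]

section Auxiliary

/-- The radial majorant `‖x‖⁻² (1 + ‖x‖²)⁻²` is integrable in dimension four. -/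
lemma integrable_inv_norm_sq_mul_one_add_norm_sq_sq :
    Integrable (fun x : EuclideanSpace ℝ (Fin 4) => 1 / (‖x‖ ^ 2 * (1 + ‖x‖ ^ 2) ^ 2)) := by
  refine (integrable_fun_norm_addHaar (volume : Measure (EuclideanSpace ℝ (Fin 4)))
    (f := fun y : ℝ => 1 / (y ^ 2 * (1 + y ^ 2) ^ 2))).2 ?_
  rw [finrank_euclideanSpace_fin]
  refine Integrable.mono' (integrable_inv_one_add_sq.integrableOn) ?_ ?_
  · exact (by fun_prop : Measurable fun y : ℝ =>
      y ^ (4 - 1) • (1 / (y ^ 2 * (1 + y ^ 2) ^ 2))).aestronglyMeasurable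
  · refine (ae_restrict_mem measurableSet_Ioi).mono fun y (hy : 0 < y) => ?_
    have hsimp : y ^ (4 - 1) • (1 / (y ^ 2 * (1 + y ^ 2) ^ 2)) = y / (1 + y ^ 2) ^ 2 := by
      simp only [smul_eq_mul]
      field_simp
    rw [hsimp, Real.norm_of_nonneg (by positivity), inv_eq_one_div,
      div_le_div_iff₀ (by positivity) (by positivity)]
    nlinarith [sq_nonneg (y - 1), sq_nonneg y, mul_nonneg (sq_nonneg y) (sq_nonneg (y - 1)),
      mul_nonneg (sq_nonneg y) hy.le]

/-- If `x` is the smallest of three nonnegative reals, the product of inverse squares is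
controlled by a function of `x` alone. -/
lemma one_div_sq_mul_sq_mul_sq_le_of_le {d x y z : ℝ} (hd : 0 < d) (hx : 0 ≤ x) (hxy : x ≤ y)
    (hxz : x ≤ z) (hdy : d ≤ x + y) (hdz : d ≤ x + z) :
    1 / (x ^ 2 * y ^ 2 * z ^ 2) ≤ (4 / d ^ 2 + 1) ^ 2 * (1 / (x ^ 2 * (1 + x ^ 2) ^ 2)) := by
  rcases hx.eq_or_lt with rfl | hx
  · simp
  have key : ∀ t, x ≤ t → d ≤ x + t → 1 + x ^ 2 ≤ (4 / d ^ 2 + 1) * t ^ 2 := by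
    intro t hxt hdt
    have h1 : 1 ≤ 4 / d ^ 2 * t ^ 2 := by
      rw [div_mul_eq_mul_div, one_le_div (by positivity)]
      nlinarith
    nlinarith
  have hy := key y hxy hdy
  have hz := key z hxz hdz
  have hy0 : 0 < y := hx.trans_le hxy
  have hz0 : 0 < z := hx.trans_le hxz
  rw [mul_one_div, div_le_div_iff₀ (by positivity) (by positivity), one_mul]
  calc x ^ 2 * (1 + x ^ 2) ^ 2 = x ^ 2 * ((1 + x ^ 2) * (1 + x ^ 2)) := by ring
    _ ≤ x ^ 2 * (((4 / d ^ 2 + 1) * y ^ 2) * ((4 / d ^ 2 + 1) * z ^ 2)) := by gcongr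
    _ = (4 / d ^ 2 + 1) ^ 2 * (x ^ 2 * y ^ 2 * z ^ 2) := by ring

/-- The one-loop triangle integrand with three distinct poles is integrable on `ℝ⁴`. -/
lemma integrable_one_div_norm_sq_mul_norm_sub_sq {a b : EuclideanSpace ℝ (Fin 4)} (ha : a ≠ 0)
    (hb : b ≠ 0) (hab : a ≠ b) :
    Integrable (fun x : EuclideanSpace ℝ (Fin 4) =>
      1 / (‖x‖ ^ 2 * ‖x - a‖ ^ 2 * ‖x - b‖ ^ 2)) := by
  obtain ⟨d, hd, hda, hdb, hdab⟩ : ∃ d : ℝ, 0 < d ∧ d ≤ ‖a‖ ∧ d ≤ ‖b‖ ∧ d ≤ ‖a - b‖ :=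
    ⟨min ‖a‖ (min ‖b‖ ‖a - b‖), by
      simp [ha, hb, sub_ne_zero.2 hab], min_le_left _ _,
      (min_le_right _ _).trans (min_le_left _ _), (min_le_right _ _).trans (min_le_right _ _)⟩
  have hg := integrable_inv_norm_sq_mul_one_add_norm_sq_sq
  refine Integrable.mono' (((hg.add (hg.comp_sub_right a)).add (hg.comp_sub_right b)).const_mul
    ((4 / d ^ 2 + 1) ^ 2)) ?_ (Filter.Eventually.of_forall fun x => ?_)
  · exact (by fun_prop : Measurable fun x : EuclideanSpace ℝ (Fin 4) =>
      1 / (‖x‖ ^ 2 * ‖x - a‖ ^ 2 * ‖x - b‖ ^ 2)).aestronglyMeasurable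
  · rw [Real.norm_of_nonneg (by positivity)]
    simp only [Pi.add_apply, mul_add]
    have hxa : d ≤ ‖x‖ + ‖x - a‖ := hda.trans <| by
      simpa using norm_sub_le x (x - a)
    have hxb : d ≤ ‖x‖ + ‖x - b‖ := hdb.trans <| by
      simpa using norm_sub_le x (x - b)
    have hxab : d ≤ ‖x - a‖ + ‖x - b‖ := hdab.trans <| by
      simpa [norm_sub_rev] using norm_sub_le (x - a) (x - b)
    have of_min : (‖x‖ ≤ ‖x - a‖ ∧ ‖x‖ ≤ ‖x - b‖) ∨ (‖x - a‖ ≤ ‖x‖ ∧ ‖x - a‖ ≤ ‖x - b‖) ∨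
        (‖x - b‖ ≤ ‖x‖ ∧ ‖x - b‖ ≤ ‖x - a‖) := by
      rcases le_total ‖x‖ ‖x - a‖ with h | h
      · rcases le_total ‖x‖ ‖x - b‖ with h' | h'
        · exact .inl ⟨h, h'⟩
        · exact .inr (.inr ⟨h', h'.trans h⟩)
      · rcases le_total ‖x - a‖ ‖x - b‖ with h' | h'
        · exact .inr (.inl ⟨h, h'⟩)
        · exact .inr (.inr ⟨h'.trans h, h'⟩)
    have pos : ∀ t : ℝ, 0 ≤ (4 / d ^ 2 + 1) ^ 2 * (1 / (t ^ 2 * (1 + t ^ 2) ^ 2)) :=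
      fun t => by positivity
    have px := pos ‖x‖
    have pa := pos ‖x - a‖
    have pb := pos ‖x - b‖
    rcases of_min with ⟨h, h'⟩ | ⟨h, h'⟩ | ⟨h, h'⟩
    · have := one_div_sq_mul_sq_mul_sq_le_of_le hd (norm_nonneg x) h h' hxa hxb
      linarith
    · have := one_div_sq_mul_sq_mul_sq_le_of_le hd (norm_nonneg (x - a)) h h'
        (by linarith) hxab
      rw [mul_comm (‖x - a‖ ^ 2)] at this
      linarith
    · have := one_div_sq_mul_sq_mul_sq_le_of_le hd (norm_nonneg (x - b)) h h'
        (by linarith) (by linarith)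
      rw [mul_assoc, mul_comm] at this
      linarith

/-- Two vectors with the same Gram matrix as `e4` and `uOf z` are the images of those points under
a linear isometry. -/
lemma exists_linearIsometryEquiv_e4_uOf {z : ℂ} (hz : z.im ≠ 0)
    {v w : EuclideanSpace ℝ (Fin 4)} (hv : ‖v‖ = 1) (hvw : inner ℝ v w = z.re)
    (hw : ‖w‖ ^ 2 = z.re ^ 2 + z.im ^ 2) :
    ∃ A : EuclideanSpace ℝ (Fin 4) ≃ₗᵢ[ℝ] EuclideanSpace ℝ (Fin 4),
      A e4 = v ∧ A (uOf z) = w := by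
  set f : EuclideanSpace ℝ (Fin 4) := z.im⁻¹ • (w - z.re • v) with hf
  have hvv : inner ℝ v v = (1 : ℝ) := by rw [real_inner_self_eq_norm_sq, hv, one_pow]
  have hww : inner ℝ w w = z.re ^ 2 + z.im ^ 2 := by rw [real_inner_self_eq_norm_sq, hw]
  have hwv : inner ℝ w v = z.re := by rw [real_inner_comm, hvw]
  have hvf : inner ℝ v f = (0 : ℝ) := by
    simp only [hf, inner_smul_right, inner_sub_right, hvw, hvv, mul_one, sub_self, mul_zero]
  have hff : inner ℝ f f = (1 : ℝ) := by
    simp only [hf, inner_smul_right, inner_sub_right, inner_smul_left, inner_sub_left, hvw, hvv,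
      hwv, hww, conj_trivial]
    field_simp
    ring
  have hon : Orthonormal ℝ
      (({0, 1} : Set (Fin 4)).domRestrict (![v, f, 0, 0] : Fin 4 → EuclideanSpace ℝ (Fin 4))) := by
    rw [orthonormal_iff_ite]
    have hfv : inner ℝ f v = (0 : ℝ) := by rw [real_inner_comm, hvf]
    rintro ⟨i, rfl | rfl⟩ ⟨j, rfl | rfl⟩ <;>
      simp [-inner_self_eq_norm_sq_to_K, Subtype.ext_iff,
        Set.domRestrict_apply, hvf, hff, hfv, hvv]
  obtain ⟨b, hb⟩ := hon.exists_orthonormalBasis_extension_of_card_eq (by simp)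
  have hb0 : b 0 = v := hb 0 (by simp)
  have hb1 : b 1 = f := hb 1 (by simp)
  refine ⟨b.repr.symm, ?_, ?_⟩
  · rw [← b.sum_repr_symm]
    simp [Fin.sum_univ_four, e4, hb0]
  · rw [← b.sum_repr_symm]
    simp [Fin.sum_univ_four, uOf, hb0, hb1, hf, smul_smul, hz]

end Auxiliary

/-- Generalized Fourier identity, simplest (K5) instance: the momentum-space one-loop
triangle equals `1/‖q‖²` times the position-space one-loop integral. -/
theorem generalized_fourier_identity_K5
    (p₁ p₂ : EuclideanSpace ℝ (Fin 4)) (hind : LinearIndependent ℝ ![p₁, p₂])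
    (q : EuclideanSpace ℝ (Fin 4)) (hq : q = -p₁ - p₂)
    (z : ℂ) (hz : z.im ≠ 0)
    (h1 : z * (starRingEnd ℂ) z = ((‖p₁‖ ^ 2 / ‖q‖ ^ 2 : ℝ) : ℂ))
    (h2 : (1 - z) * (1 - (starRingEnd ℂ) z) = ((‖p₂‖ ^ 2 / ‖q‖ ^ 2 : ℝ) : ℂ)) :
    Integrable (fun l : EuclideanSpace ℝ (Fin 4) =>
        1 / (‖l‖ ^ 2 * ‖l + p₁‖ ^ 2 * ‖l - q‖ ^ 2)) ∧
    Integrable (fun x : EuclideanSpace ℝ (Fin 4) =>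
        1 / (‖x‖ ^ 2 * ‖x - e4‖ ^ 2 * ‖x - uOf z‖ ^ 2)) ∧
    (∫ l : EuclideanSpace ℝ (Fin 4), 1 / (‖l‖ ^ 2 * ‖l + p₁‖ ^ 2 * ‖l - q‖ ^ 2)) =
      (1 / ‖q‖ ^ 2) *
        ∫ x : EuclideanSpace ℝ (Fin 4), 1 / (‖x‖ ^ 2 * ‖x - e4‖ ^ 2 * ‖x - uOf z‖ ^ 2) := by
  have hp₁ : p₁ ≠ 0 := hind.ne_zero 0
  have hp₂ : p₂ ≠ 0 := hind.ne_zero 1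
  have hq0 : q ≠ 0 := by
    intro h
    have := (LinearIndependent.pair_iff.1 hind) 1 1 (by
      rw [one_smul, one_smul, ← neg_eq_zero, neg_add', ← hq, h])
    simp at this
  have hnq : 0 < ‖q‖ := norm_pos_iff.2 hq0
  have h1' : z.re ^ 2 + z.im ^ 2 = ‖p₁‖ ^ 2 / ‖q‖ ^ 2 := by
    have := congrArg Complex.re h1
    rw [Complex.ofReal_re] at this
    rw [← this]
    simp [Complex.mul_re]
    ring
  have h2' : (1 - z.re) ^ 2 + z.im ^ 2 = ‖p₂‖ ^ 2 / ‖q‖ ^ 2 := by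
    have := congrArg Complex.re h2
    rw [Complex.ofReal_re] at this
    rw [← this]
    simp [Complex.mul_re]
    ring
  have hp₂q : ‖p₂‖ ^ 2 = ‖q‖ ^ 2 + 2 * inner ℝ q p₁ + ‖p₁‖ ^ 2 := by
    rw [← norm_add_sq_real, ← norm_neg p₂, hq]
    congr 2
    abel
  have hre : inner ℝ q p₁ = -(z.re * ‖q‖ ^ 2) := by
    rw [eq_div_iff (by positivity)] at h1' h2'
    linarith
  obtain ⟨A, hAe, hAu⟩ := exists_linearIsometryEquiv_e4_uOf (z := z) hz
    (v := ‖q‖⁻¹ • q) (w := ‖q‖⁻¹ • (-p₁))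
    (by rw [norm_smul, norm_inv, norm_norm, inv_mul_cancel₀ hnq.ne'])
    (by
      rw [inner_smul_left, inner_smul_right, inner_neg_right, hre, conj_trivial]
      field_simp)
    (by
      rw [norm_smul, norm_inv, norm_norm, norm_neg, mul_pow, h1']
      field_simp)
  have hAe' : ‖q‖ • A e4 = q := by rw [hAe, smul_inv_smul₀ hnq.ne']
  have hAu' : ‖q‖ • A (uOf z) = -p₁ := by rw [hAu, smul_inv_smul₀ hnq.ne']
  have he0 : e4 ≠ 0 := by
    intro h
    rw [h, map_zero, smul_zero] at hAe'
    exact hq0 hAe'.symm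
  have hu0 : uOf z ≠ 0 := by
    intro h
    rw [h, map_zero, smul_zero] at hAu'
    exact hp₁ (neg_eq_zero.1 hAu'.symm)
  have hqp : -p₁ ≠ q := by
    rw [hq, ne_comm, Ne, sub_eq_self]
    exact hp₂
  have heu : e4 ≠ uOf z := by
    intro h
    rw [← h, hAe'] at hAu'
    exact hqp hAu'.symm
  refine ⟨?_, integrable_one_div_norm_sq_mul_norm_sub_sq he0 hu0 heu, ?_⟩
  · simpa only [sub_neg_eq_add] using
      integrable_one_div_norm_sq_mul_norm_sub_sq (neg_ne_zero.2 hp₁) hq0 hqp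
  set F : EuclideanSpace ℝ (Fin 4) → ℝ :=
    fun l => 1 / (‖l‖ ^ 2 * ‖l + p₁‖ ^ 2 * ‖l - q‖ ^ 2) with hF
  have hscale : ∀ x, F (‖q‖ • A x) =
      (‖q‖ ^ 6)⁻¹ * (1 / (‖x‖ ^ 2 * ‖x - e4‖ ^ 2 * ‖x - uOf z‖ ^ 2)) := by
    intro x
    have n0 : ‖‖q‖ • A x‖ = ‖q‖ * ‖x‖ := by rw [norm_smul, norm_norm, A.norm_map]
    have n1 : ‖‖q‖ • A x - q‖ = ‖q‖ * ‖x - e4‖ := by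
      nth_rewrite 2 [← hAe']
      rw [← smul_sub, ← map_sub, norm_smul, norm_norm, A.norm_map]
    have n2 : ‖‖q‖ • A x + p₁‖ = ‖q‖ * ‖x - uOf z‖ := by
      rw [← sub_neg_eq_add, ← hAu', ← smul_sub, ← map_sub, norm_smul, norm_norm, A.norm_map]
    simp only [hF, n0, n1, n2]
    rw [one_div, one_div, ← mul_inv]
    congr 1
    ring
  have hint : ∫ x, F (‖q‖ • A x) = (‖q‖ ^ 4)⁻¹ * ∫ l, F l := by
    rw [A.measurePreserving.integral_comp A.toHomeomorph.measurableEmbedding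
      (fun y => F (‖q‖ • y)), Measure.integral_comp_smul, finrank_euclideanSpace_fin,
      abs_of_nonneg (by positivity), smul_eq_mul]
  simp only [hscale, integral_const_mul] at hint
  rw [← mul_right_inj' (inv_ne_zero (pow_ne_zero 4 hnq.ne')), ← hint, ← mul_assoc]
  congr 1
  field_simp
end

section
/- Star-triangle (uniqueness) relation: Let D be a positive integer, let a, b, c ∈ ℝ satisfy 0 < a < D/2, 0 < b < D/2, 0 < c < D/2 and a + b + c = D, and let x₁, x₂, x₃ ∈ ℝ^D be pairwise distinct. Then the function x ↦ ‖x-x₁‖^{-2a}·‖x-x₂‖^{-2b}·‖x-x₃‖^{-2c} is Lebesgue integrable on ℝ^D and ∫_{ℝ^D} ‖x-x₁‖^{-2a} ‖x-x₂‖^{-2b} ‖x-x₃‖^{-2c} dx = π^{D/2} · (Γ(D/2-a)·Γ(D/2-b)·Γ(D/2-c)) / (Γ(a)·Γ(b)·Γ(c)) · ‖x₁-x₂‖^{-2(D/2-c)} · ‖x₂-x₃‖^{-2(D/2-a)} · ‖x₁-x₃‖^{-2(D/2-b)}. -/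
open MeasureTheory

open Set in
/-- Euler's integral `∫₀^∞ t ^ (p - 1) * exp (-r t) dt = r ^ (-p) Γ(p)` as a Lebesgue integral. -/
theorem lintegral_rpow_mul_exp_neg_mul_Ioi {p r : ℝ} (hp : 0 < p) (hr : 0 < r) :
    ∫⁻ t in Ioi (0 : ℝ), ENNReal.ofReal (t ^ (p - 1) * Real.exp (-(r * t))) =
      ENNReal.ofReal (r ^ (-p) * Real.Gamma p) := by
  have hval := Real.integral_rpow_mul_exp_neg_mul_Ioi hp hr
  have hpos : 0 < (1 / r) ^ p * Real.Gamma p := by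
    have := Real.Gamma_pos_of_pos hp
    positivity
  rw [← ofReal_integral_eq_lintegral_ofReal
    (Integrable.of_integral_ne_zero (hval ▸ hpos.ne')), hval, one_div, Real.inv_rpow hr.le,
    Real.rpow_neg hr.le]
  filter_upwards [ae_restrict_mem measurableSet_Ioi] with t ht
  have : (0 : ℝ) < t := ht
  simp only [Pi.zero_apply]
  positivity

open Set in
/-- Schwinger's trick: the integral of `w * g ^ (-l)` is determined by the Laplace transform
`u ↦ ∫ w * exp (-u g)` when the latter has the form `C * u ^ (-b) * exp (-u B)`. -/
theorem lintegral_mul_rpow_neg_of_laplace {X : Type*} [MeasurableSpace X] {μ : Measure X}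
    [SFinite μ] {w g : X → ℝ} (hw : Measurable w) (hg : Measurable g)
    (hw0 : ∀ᵐ x ∂μ, 0 ≤ w x) (hg0 : ∀ᵐ x ∂μ, 0 < g x)
    {C b l B : ℝ} (hC : 0 ≤ C) (hl : 0 < l) (hbl : b < l) (hB : 0 < B)
    (hL : ∀ u : ℝ, 0 < u → ∫⁻ x, ENNReal.ofReal (w x * Real.exp (-(g x * u))) ∂μ =
      ENNReal.ofReal (C * u ^ (-b) * Real.exp (-(B * u)))) :
    ∫⁻ x, ENNReal.ofReal (w x * g x ^ (-l)) ∂μ =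
      ENNReal.ofReal (C * B ^ (b - l) * (Real.Gamma (l - b) / Real.Gamma l)) := by
  have hΓ := Real.Gamma_pos_of_pos hl
  have expand : ∀ᵐ x ∂μ, ENNReal.ofReal (w x * g x ^ (-l)) =
      ∫⁻ u in Ioi (0 : ℝ), ENNReal.ofReal
        ((Real.Gamma l)⁻¹ * w x * (u ^ (l - 1) * Real.exp (-(g x * u)))) := by
    filter_upwards [hw0, hg0] with x hwx hgx
    have h0 : 0 ≤ (Real.Gamma l)⁻¹ * w x := by positivity
    simp_rw [ENNReal.ofReal_mul h0]
    rw [lintegral_const_mul _ (by fun_prop), lintegral_rpow_mul_exp_neg_mul_Ioi hl hgx,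
      ← ENNReal.ofReal_mul h0]
    congr 1
    field_simp
  have inner : ∀ u ∈ Ioi (0 : ℝ), ∫⁻ x, ENNReal.ofReal
        ((Real.Gamma l)⁻¹ * w x * (u ^ (l - 1) * Real.exp (-(g x * u)))) ∂μ =
      ENNReal.ofReal ((Real.Gamma l)⁻¹ * C) *
        ENNReal.ofReal (u ^ (l - b - 1) * Real.exp (-(B * u))) := by
    intro u hu
    have hu : (0 : ℝ) < u := hu
    have h0 : 0 ≤ (Real.Gamma l)⁻¹ * u ^ (l - 1) := by positivity
    have hrw : ∀ x, (Real.Gamma l)⁻¹ * w x * (u ^ (l - 1) * Real.exp (-(g x * u))) =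
        (Real.Gamma l)⁻¹ * u ^ (l - 1) * (w x * Real.exp (-(g x * u))) := fun x => by ring
    simp_rw [hrw, ENNReal.ofReal_mul h0]
    rw [lintegral_const_mul _ (by fun_prop), hL u hu, ← ENNReal.ofReal_mul h0,
      ← ENNReal.ofReal_mul (by positivity), show l - b - 1 = (l - 1) + -b by ring,
      Real.rpow_add hu]
    congr 1
    ring
  rw [lintegral_congr_ae expand, lintegral_lintegral_swap (by unfold Function.uncurry; fun_prop),
    setLIntegral_congr_fun measurableSet_Ioi inner, lintegral_const_mul _ (by fun_prop),
    lintegral_rpow_mul_exp_neg_mul_Ioi (by linarith) hB, ← ENNReal.ofReal_mul (by positivity),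
    neg_sub]
  congr 1
  ring

open Set in
/-- Euler's beta integral over the half-line. -/
theorem lintegral_rpow_mul_add_rpow_neg_Ioi {A B b l : ℝ} (hA : 0 < A) (hB : 0 < B)
    (hb : 0 < b) (hbl : b < l) :
    ∫⁻ t in Ioi (0 : ℝ), ENNReal.ofReal (t ^ (b - 1) * (t * A + B) ^ (-l)) =
      ENNReal.ofReal (A ^ (-b) * B ^ (b - l) *
        (Real.Gamma b * Real.Gamma (l - b) / Real.Gamma l)) := by
  have hΓ := Real.Gamma_pos_of_pos hb
  have hpos : ∀ᵐ t ∂volume.restrict (Ioi (0 : ℝ)), 0 < t := ae_restrict_mem measurableSet_Ioi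
  rw [lintegral_mul_rpow_neg_of_laplace (b := b) (C := A ^ (-b) * Real.Gamma b) (B := B)
    (by fun_prop) (by fun_prop) (hpos.mono fun t ht => by positivity)
    (hpos.mono fun t ht => by positivity) (by positivity) (hb.trans hbl) hbl hB]
  · congr 1
    ring
  · intro u hu
    have hrw : ∀ t : ℝ, t ^ (b - 1) * Real.exp (-((t * A + B) * u)) =
        Real.exp (-(B * u)) * (t ^ (b - 1) * Real.exp (-(A * u * t))) := fun t => by
      rw [mul_left_comm, ← Real.exp_add]
      ring_nf
    simp_rw [hrw, ENNReal.ofReal_mul (Real.exp_pos _).le]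
    rw [lintegral_const_mul _ (by fun_prop),
      lintegral_rpow_mul_exp_neg_mul_Ioi hb (by positivity),
      ← ENNReal.ofReal_mul (Real.exp_pos _).le, Real.mul_rpow hA.le hu.le]
    congr 1
    ring

section InnerProduct

variable {V : Type*} [NormedAddCommGroup V] [InnerProductSpace ℝ V]

/-- Completing the square in a weighted sum of three squared distances. -/
theorem weighted_sq_norm_sub_eq {s t : ℝ} (hst : s + t + 1 ≠ 0) (x x₁ x₂ x₃ : V) :
    s * ‖x - x₁‖ ^ 2 + t * ‖x - x₂‖ ^ 2 + ‖x - x₃‖ ^ 2 =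
      (s + t + 1) * ‖x - (s + t + 1)⁻¹ • (s • x₁ + t • x₂ + x₃)‖ ^ 2 +
        (s * t * ‖x₁ - x₂‖ ^ 2 + s * ‖x₁ - x₃‖ ^ 2 + t * ‖x₂ - x₃‖ ^ 2) / (s + t + 1) := by
  simp only [norm_sub_sq_real, norm_add_sq_real, norm_smul, inner_add_left, inner_add_right,
    inner_smul_left, inner_smul_right, mul_pow, Real.norm_eq_abs, sq_abs, conj_trivial]
  field_simp
  ring

variable [FiniteDimensional ℝ V] [MeasurableSpace V] [BorelSpace V]

open Module in
/-- The massive one-loop tadpole integral. -/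
theorem lintegral_mul_sq_norm_add_rpow_neg {S R l : ℝ} (hS : 0 < S) (hR : 0 < R)
    (hl : 0 < l) (hdl : (finrank ℝ V : ℝ) / 2 < l) (m : V) :
    ∫⁻ x : V, ENNReal.ofReal ((S * ‖x - m‖ ^ 2 + R) ^ (-l)) =
      ENNReal.ofReal ((Real.pi / S) ^ ((finrank ℝ V : ℝ) / 2) * R ^ ((finrank ℝ V : ℝ) / 2 - l) *
        (Real.Gamma (l - (finrank ℝ V : ℝ) / 2) / Real.Gamma l)) := by
  rw [lintegral_sub_right_eq_self (fun x : V => ENNReal.ofReal ((S * ‖x‖ ^ 2 + R) ^ (-l))) m]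
  have hC : 0 ≤ (Real.pi / S) ^ ((finrank ℝ V : ℝ) / 2) := by positivity
  rw [← lintegral_mul_rpow_neg_of_laplace (μ := (volume : Measure V)) (w := fun _ => 1)
    (g := fun x => S * ‖x‖ ^ 2 + R) (by fun_prop) (by fun_prop) (by simp)
    (ae_of_all _ fun x => by positivity) hC hl hdl hR]
  · simp
  · intro u hu
    have hrw : ∀ x : V, 1 * Real.exp (-((S * ‖x‖ ^ 2 + R) * u)) =
        Real.exp (-(R * u)) * Real.exp (-(S * u) * ‖x‖ ^ 2) := fun x => by
      rw [one_mul, ← Real.exp_add]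
      ring_nf
    have hval := GaussianFourier.integral_rexp_neg_mul_sq_norm (V := V) (mul_pos hS hu)
    have hint : Integrable fun x : V => Real.exp (-(S * u) * ‖x‖ ^ 2) :=
      Integrable.of_integral_ne_zero (by rw [hval]; positivity)
    simp_rw [hrw, ENNReal.ofReal_mul (Real.exp_pos _).le]
    rw [lintegral_const_mul _ (by fun_prop), ← ofReal_integral_eq_lintegral_ofReal hint
      (ae_of_all _ fun x => (Real.exp_pos _).le), hval, ← ENNReal.ofReal_mul (Real.exp_pos _).le,
      ← div_div, Real.div_rpow (by positivity) hu.le, Real.rpow_neg hu.le]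
    congr 1
    ring

end InnerProduct

open Set in
/-- Feynman's parametrization of a product of three powers. -/
theorem lintegral_feynman_three {a b c A B C : ℝ} (ha : 0 < a) (hb : 0 < b) (hc : 0 < c)
    (hA : 0 < A) (hB : 0 < B) (hC : 0 < C) :
    ∫⁻ s in Ioi (0 : ℝ), ∫⁻ t in Ioi (0 : ℝ), ENNReal.ofReal
        (s ^ (a - 1) * t ^ (b - 1) * (s * A + t * B + C) ^ (-(a + b + c))) =
      ENNReal.ofReal (A ^ (-a) * B ^ (-b) * C ^ (-c) *
        (Real.Gamma a * Real.Gamma b * Real.Gamma c / Real.Gamma (a + b + c))) := by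
  have hΓb := Real.Gamma_pos_of_pos hb
  have hΓac := Real.Gamma_pos_of_pos (add_pos ha hc)
  have hΓ := Real.Gamma_pos_of_pos (add_pos (add_pos ha hb) hc)
  have hK : 0 ≤ B ^ (-b) * (Real.Gamma b * Real.Gamma (a + c) / Real.Gamma (a + b + c)) := by
    positivity
  have inner : ∀ s ∈ Ioi (0 : ℝ), ∫⁻ t in Ioi (0 : ℝ), ENNReal.ofReal
        (s ^ (a - 1) * t ^ (b - 1) * (s * A + t * B + C) ^ (-(a + b + c))) =
      ENNReal.ofReal (B ^ (-b) * (Real.Gamma b * Real.Gamma (a + c) / Real.Gamma (a + b + c))) *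
        ENNReal.ofReal (s ^ (a - 1) * (s * A + C) ^ (-(a + c))) := by
    intro s hs
    have hs : (0 : ℝ) < s := hs
    have h0 : 0 ≤ s ^ (a - 1) := by positivity
    have hrw : ∀ t : ℝ, s * A + t * B + C = t * B + (s * A + C) := fun t => by ring
    simp_rw [mul_assoc (s ^ (a - 1)), ENNReal.ofReal_mul h0, hrw]
    rw [lintegral_const_mul _ (by fun_prop),
      lintegral_rpow_mul_add_rpow_neg_Ioi hB (by positivity) hb (by linarith),
      ← ENNReal.ofReal_mul h0, ← ENNReal.ofReal_mul h0, ← ENNReal.ofReal_mul hK,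
      show a + b + c - b = a + c by ring, show b - (a + b + c) = -(a + c) by ring]
    congr 1
    ring
  rw [setLIntegral_congr_fun measurableSet_Ioi inner, lintegral_const_mul _ (by fun_prop),
    lintegral_rpow_mul_add_rpow_neg_Ioi hA hC ha (by linarith), ← ENNReal.ofReal_mul hK,
    show a + c - a = c by ring, show a - (a + c) = -c by ring]
  congr 1
  field_simp

open Set in
/-- The Cheng–Wu form of the Symanzik parametric integral of the star with unit total index. -/
theorem lintegral_symanzik_three {a b d p q r : ℝ} (hb : 0 < b) (had : a < d) (hbd : b < d)
    (habd : d < a + b) (hp : 0 < p) (hq : 0 < q) (hr : 0 < r) :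
    ∫⁻ s in Ioi (0 : ℝ), ∫⁻ t in Ioi (0 : ℝ), ENNReal.ofReal
        (s ^ (a - 1) * t ^ (b - 1) * (s * t * p + s * q + t * r) ^ (-d)) =
      ENNReal.ofReal (p ^ (-(a + b - d)) * r ^ (-(d - a)) * q ^ (-(d - b)) *
        (Real.Gamma (d - a) * Real.Gamma (d - b) * Real.Gamma (a + b - d) / Real.Gamma d)) := by
  have hΓb := Real.Gamma_pos_of_pos hb
  have hΓdb := Real.Gamma_pos_of_pos (sub_pos.2 hbd)
  have hΓd := Real.Gamma_pos_of_pos (hb.trans hbd)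
  have hK : 0 ≤ q ^ (-(d - b)) * (Real.Gamma b * Real.Gamma (d - b) / Real.Gamma d) := by
    positivity
  have inner : ∀ s ∈ Ioi (0 : ℝ), ∫⁻ t in Ioi (0 : ℝ), ENNReal.ofReal
        (s ^ (a - 1) * t ^ (b - 1) * (s * t * p + s * q + t * r) ^ (-d)) =
      ENNReal.ofReal (q ^ (-(d - b)) * (Real.Gamma b * Real.Gamma (d - b) / Real.Gamma d)) *
        ENNReal.ofReal (s ^ (a + b - d - 1) * (s * p + r) ^ (-b)) := by
    intro s hs
    have hs : (0 : ℝ) < s := hs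
    have h0 : 0 ≤ s ^ (a - 1) := by positivity
    have hrw : ∀ t : ℝ, s * t * p + s * q + t * r = t * (s * p + r) + s * q := fun t => by ring
    simp_rw [mul_assoc (s ^ (a - 1)), ENNReal.ofReal_mul h0, hrw]
    rw [lintegral_const_mul _ (by fun_prop),
      lintegral_rpow_mul_add_rpow_neg_Ioi (by positivity) (by positivity) hb hbd,
      ← ENNReal.ofReal_mul h0, ← ENNReal.ofReal_mul hK, Real.mul_rpow hs.le hq.le,
      show a + b - d - 1 = (a - 1) + (b - d) by ring, Real.rpow_add hs, neg_sub]
    congr 1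
    ring
  rw [setLIntegral_congr_fun measurableSet_Ioi inner, lintegral_const_mul _ (by fun_prop),
    lintegral_rpow_mul_add_rpow_neg_Ioi hp hr (by linarith) (by linarith),
    ← ENNReal.ofReal_mul hK, show b - (a + b - d) = d - a by ring,
    show a + b - d - b = -(d - a) by ring]
  congr 1
  field_simp

open Set in
/-- The star-triangle relation for the `ℝ≥0∞`-valued integral. -/
theorem lintegral_star_triangle {V : Type*} [NormedAddCommGroup V] [InnerProductSpace ℝ V]
    [FiniteDimensional ℝ V] [MeasurableSpace V] [BorelSpace V] {a b c d : ℝ}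
    (hd : d = (Module.finrank ℝ V : ℝ) / 2)
    (ha : 0 < a) (had : a < d) (hb : 0 < b) (hbd : b < d) (hc : 0 < c) (hcd : c < d)
    (habc : a + b + c = 2 * d) {x₁ x₂ x₃ : V} (h12 : x₁ ≠ x₂) (h13 : x₁ ≠ x₃) (h23 : x₂ ≠ x₃) :
    ∫⁻ x : V, ENNReal.ofReal
        (‖x - x₁‖ ^ (-2 * a) * ‖x - x₂‖ ^ (-2 * b) * ‖x - x₃‖ ^ (-2 * c)) =
      ENNReal.ofReal (Real.pi ^ d *
        (Real.Gamma (d - a) * Real.Gamma (d - b) * Real.Gamma (d - c)) /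
        (Real.Gamma a * Real.Gamma b * Real.Gamma c) *
        ‖x₁ - x₂‖ ^ (-2 * (d - c)) * ‖x₂ - x₃‖ ^ (-2 * (d - a)) *
        ‖x₁ - x₃‖ ^ (-2 * (d - b))) := by
  have hΓa := Real.Gamma_pos_of_pos ha
  have hΓb := Real.Gamma_pos_of_pos hb
  have hΓc := Real.Gamma_pos_of_pos hc
  have hd0 : 0 < d := ha.trans had
  have hΓd := Real.Gamma_pos_of_pos hd0
  have hΓ2d := Real.Gamma_pos_of_pos (show 0 < 2 * d by linarith)
  have hp : 0 < ‖x₁ - x₂‖ := norm_pos_iff.2 (sub_ne_zero.2 h12)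
  have hq : 0 < ‖x₁ - x₃‖ := norm_pos_iff.2 (sub_ne_zero.2 h13)
  have hr : 0 < ‖x₂ - x₃‖ := norm_pos_iff.2 (sub_ne_zero.2 h23)
  have sq_rpow : ∀ y e : ℝ, 0 ≤ y → (y ^ 2) ^ (-e) = y ^ (-2 * e) := fun y e hy => by
    rw [← Real.rpow_natCast, ← Real.rpow_mul hy]
    congr 1
    push_cast
    ring
  have : Nontrivial V := ⟨x₁, x₂, h12⟩
  set K := Real.Gamma (2 * d) / (Real.Gamma a * Real.Gamma b * Real.Gamma c) with hK
  have hK0 : 0 < K := by positivity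
  have ae_ne : ∀ y : V, ∀ᵐ x : V, x ≠ y := fun y => Measure.ae_ne volume y
  have feynman : ∀ᵐ x : V, ENNReal.ofReal
        (‖x - x₁‖ ^ (-2 * a) * ‖x - x₂‖ ^ (-2 * b) * ‖x - x₃‖ ^ (-2 * c)) =
      ENNReal.ofReal K * ∫⁻ s in Ioi (0 : ℝ), ∫⁻ t in Ioi (0 : ℝ), ENNReal.ofReal
        (s ^ (a - 1) * t ^ (b - 1) *
          (s * ‖x - x₁‖ ^ 2 + t * ‖x - x₂‖ ^ 2 + ‖x - x₃‖ ^ 2) ^ (-(2 * d))) := by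
    filter_upwards [ae_ne x₁, ae_ne x₂, ae_ne x₃] with x h1 h2 h3
    have h1 : 0 < ‖x - x₁‖ := norm_pos_iff.2 (sub_ne_zero.2 h1)
    have h2 : 0 < ‖x - x₂‖ := norm_pos_iff.2 (sub_ne_zero.2 h2)
    have h3 : 0 < ‖x - x₃‖ := norm_pos_iff.2 (sub_ne_zero.2 h3)
    rw [← habc, lintegral_feynman_three ha hb hc (by positivity) (by positivity) (by positivity),
      ← ENNReal.ofReal_mul hK0.le, sq_rpow _ _ h1.le, sq_rpow _ _ h2.le, sq_rpow _ _ h3.le,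
      hK, habc]
    congr 1
    field_simp
  have inner : ∀ s ∈ Ioi (0 : ℝ), ∀ t ∈ Ioi (0 : ℝ), ∫⁻ x : V, ENNReal.ofReal
        (s ^ (a - 1) * t ^ (b - 1) *
          (s * ‖x - x₁‖ ^ 2 + t * ‖x - x₂‖ ^ 2 + ‖x - x₃‖ ^ 2) ^ (-(2 * d))) =
      ENNReal.ofReal (Real.pi ^ d * (Real.Gamma d / Real.Gamma (2 * d))) *
        ENNReal.ofReal (s ^ (a - 1) * t ^ (b - 1) *
          (s * t * ‖x₁ - x₂‖ ^ 2 + s * ‖x₁ - x₃‖ ^ 2 + t * ‖x₂ - x₃‖ ^ 2) ^ (-d)) := by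
    intro s hs t ht
    have hs : (0 : ℝ) < s := hs
    have ht : (0 : ℝ) < t := ht
    have h0 : 0 ≤ s ^ (a - 1) * t ^ (b - 1) := by positivity
    simp_rw [weighted_sq_norm_sub_eq (show s + t + 1 ≠ 0 by positivity), ENNReal.ofReal_mul h0]
    rw [lintegral_const_mul _ (by fun_prop), lintegral_mul_sq_norm_add_rpow_neg (by positivity)
      (by positivity) (by linarith) (by linarith), ← hd, ← ENNReal.ofReal_mul h0,
      ← ENNReal.ofReal_mul h0, ← ENNReal.ofReal_mul (by positivity),
      show d - 2 * d = -d by ring, show 2 * d - d = d by ring,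
      Real.div_rpow (by positivity) (by positivity), Real.div_rpow (by positivity) (by positivity),
      Real.rpow_neg (x := s + t + 1) (by positivity)]
    congr 1
    have : 0 < (s + t + 1) ^ d := by positivity
    field_simp
  have inner' : ∀ s ∈ Ioi (0 : ℝ), ∫⁻ t in Ioi (0 : ℝ), ∫⁻ x : V, ENNReal.ofReal
        (s ^ (a - 1) * t ^ (b - 1) *
          (s * ‖x - x₁‖ ^ 2 + t * ‖x - x₂‖ ^ 2 + ‖x - x₃‖ ^ 2) ^ (-(2 * d))) =
      ENNReal.ofReal (Real.pi ^ d * (Real.Gamma d / Real.Gamma (2 * d))) *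
        ∫⁻ t in Ioi (0 : ℝ), ENNReal.ofReal (s ^ (a - 1) * t ^ (b - 1) *
          (s * t * ‖x₁ - x₂‖ ^ 2 + s * ‖x₁ - x₃‖ ^ 2 + t * ‖x₂ - x₃‖ ^ 2) ^ (-d)) := by
    intro s hs
    rw [setLIntegral_congr_fun measurableSet_Ioi (inner s hs),
      lintegral_const_mul _ (by fun_prop)]
  have swap : ∀ s : ℝ, ∫⁻ x : V, ∫⁻ t in Ioi (0 : ℝ), ENNReal.ofReal
        (s ^ (a - 1) * t ^ (b - 1) *
          (s * ‖x - x₁‖ ^ 2 + t * ‖x - x₂‖ ^ 2 + ‖x - x₃‖ ^ 2) ^ (-(2 * d))) =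
      ∫⁻ t in Ioi (0 : ℝ), ∫⁻ x : V, ENNReal.ofReal
        (s ^ (a - 1) * t ^ (b - 1) *
          (s * ‖x - x₁‖ ^ 2 + t * ‖x - x₂‖ ^ 2 + ‖x - x₃‖ ^ 2) ^ (-(2 * d))) :=
    fun s => lintegral_lintegral_swap (by unfold Function.uncurry; fun_prop)
  have meas : Measurable (Function.uncurry fun (x : V) (s : ℝ) =>
      ∫⁻ t in Ioi (0 : ℝ), ENNReal.ofReal (s ^ (a - 1) * t ^ (b - 1) *
        (s * ‖x - x₁‖ ^ 2 + t * ‖x - x₂‖ ^ 2 + ‖x - x₃‖ ^ 2) ^ (-(2 * d)))) := by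
    unfold Function.uncurry
    exact Measurable.lintegral_prod_right (by fun_prop)
  have meas' : Measurable fun s : ℝ => ∫⁻ t in Ioi (0 : ℝ), ENNReal.ofReal
      (s ^ (a - 1) * t ^ (b - 1) *
        (s * t * ‖x₁ - x₂‖ ^ 2 + s * ‖x₁ - x₃‖ ^ 2 + t * ‖x₂ - x₃‖ ^ 2) ^ (-d)) :=
    Measurable.lintegral_prod_right (by fun_prop)
  rw [lintegral_congr_ae feynman, lintegral_const_mul' _ _ ENNReal.ofReal_ne_top,
    lintegral_lintegral_swap meas.aemeasurable]
  simp_rw [swap]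
  rw [setLIntegral_congr_fun measurableSet_Ioi inner', lintegral_const_mul _ meas',
    lintegral_symanzik_three hb had hbd (by linarith) (by positivity) (by positivity)
      (by positivity),
    ← ENNReal.ofReal_mul (by positivity), ← ENNReal.ofReal_mul hK0.le,
    sq_rpow _ _ hp.le, sq_rpow _ _ hq.le, sq_rpow _ _ hr.le,
    show a + b - d = d - c by linarith, hK]
  congr 1
  field_simp

/-- Star-triangle (uniqueness) relation in Euclidean `ℝ^D`. -/
theorem star_triangle_relation
    (D : ℕ) (hD : 0 < D) (a b c : ℝ)
    (ha : 0 < a) (ha' : a < (D : ℝ) / 2)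
    (hb : 0 < b) (hb' : b < (D : ℝ) / 2)
    (hc : 0 < c) (hc' : c < (D : ℝ) / 2)
    (habc : a + b + c = (D : ℝ))
    (x₁ x₂ x₃ : EuclideanSpace ℝ (Fin D))
    (h12 : x₁ ≠ x₂) (h13 : x₁ ≠ x₃) (h23 : x₂ ≠ x₃) :
    Integrable (fun x : EuclideanSpace ℝ (Fin D) =>
        ‖x - x₁‖ ^ (-2 * a) * ‖x - x₂‖ ^ (-2 * b) * ‖x - x₃‖ ^ (-2 * c)) ∧
    (∫ x : EuclideanSpace ℝ (Fin D),
        ‖x - x₁‖ ^ (-2 * a) * ‖x - x₂‖ ^ (-2 * b) * ‖x - x₃‖ ^ (-2 * c)) =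
      Real.pi ^ ((D : ℝ) / 2) *
        (Real.Gamma ((D : ℝ) / 2 - a) * Real.Gamma ((D : ℝ) / 2 - b) *
          Real.Gamma ((D : ℝ) / 2 - c)) /
        (Real.Gamma a * Real.Gamma b * Real.Gamma c) *
        ‖x₁ - x₂‖ ^ (-2 * ((D : ℝ) / 2 - c)) *
        ‖x₂ - x₃‖ ^ (-2 * ((D : ℝ) / 2 - a)) *
        ‖x₁ - x₃‖ ^ (-2 * ((D : ℝ) / 2 - b)) := by
  have hmeas : AEStronglyMeasurable (fun x : EuclideanSpace ℝ (Fin D) =>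
      ‖x - x₁‖ ^ (-2 * a) * ‖x - x₂‖ ^ (-2 * b) * ‖x - x₃‖ ^ (-2 * c)) :=
    Measurable.aestronglyMeasurable (by fun_prop)
  have hnonneg : 0 ≤ᵐ[volume] fun x : EuclideanSpace ℝ (Fin D) =>
      ‖x - x₁‖ ^ (-2 * a) * ‖x - x₂‖ ^ (-2 * b) * ‖x - x₃‖ ^ (-2 * c) :=
    ae_of_all _ fun x => by positivity
  have hmain := lintegral_star_triangle (V := EuclideanSpace ℝ (Fin D)) (d := (D : ℝ) / 2)
    (by simp) ha ha' hb hb' hc hc' (by linarith) h12 h13 h23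
  refine ⟨⟨hmeas, ?_⟩, ?_⟩
  · rw [hasFiniteIntegral_iff_ofReal hnonneg, hmain]
    exact ENNReal.ofReal_lt_top
  · have hΓa := Real.Gamma_pos_of_pos ha
    have hΓb := Real.Gamma_pos_of_pos hb
    have hΓc := Real.Gamma_pos_of_pos hc
    have hΓa' := Real.Gamma_pos_of_pos (sub_pos.2 ha')
    have hΓb' := Real.Gamma_pos_of_pos (sub_pos.2 hb')
    have hΓc' := Real.Gamma_pos_of_pos (sub_pos.2 hc')
    rw [integral_eq_lintegral_of_nonneg_ae hnonneg hmeas, hmain,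
      ENNReal.toReal_ofReal (by positivity)]
end

section
/- Momentum-space star-triangle relation used in the proof of the generalized Fourier identity: Let s, t ∈ ℝ with 0 < s, 0 < t and s + t < 2, and let p₁, q ∈ ℝ⁴ with p₁ ≠ 0, q ≠ 0 and p₁ + q ≠ 0; set p₂ = -p₁ - q. Then the integrand is Lebesgue integrable on ℝ⁴ and ∫_{ℝ⁴} ‖l + p₁‖^{-2(s+t)} · ‖l - q‖^{-2(2-t)} · ‖l‖^{-2(2-s)} dl = π² · (Γ(s)·Γ(t)·Γ(2-s-t)) / (Γ(s+t)·Γ(2-t)·Γ(2-s)) · (‖q‖²)^{-(2-s-t)} · (‖p₁‖²)^{-t} · (‖p₂‖²)^{-s}. -/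
open MeasureTheory Real Set

/-- The Gamma integral with a constant factor, as a Lebesgue integral. -/
lemma lintegral_mul_rpow_mul_exp_neg_mul_Ioi {K a c : ℝ} (hK : 0 ≤ K) (ha : 0 < a) (hc : 0 < c) :
    ∫⁻ x in Ioi (0 : ℝ), ENNReal.ofReal (K * (x ^ (a - 1) * exp (-(c * x)))) =
      ENNReal.ofReal (K * (Gamma a * c ^ (-a))) := by
  have h := integral_rpow_mul_exp_neg_mul_Ioi ha hc
  have hpos : 0 < (1 / c) ^ a * Gamma a := by have := Gamma_pos_of_pos ha; positivity
  have hint : Integrable (fun x : ℝ => x ^ (a - 1) * exp (-(c * x)))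
      (volume.restrict (Ioi 0)) := .of_integral_ne_zero (by rw [h]; exact hpos.ne')
  rw [← ofReal_integral_eq_lintegral_ofReal (hint.const_mul K), integral_const_mul, h,
    one_div, inv_rpow hc.le, rpow_neg hc.le, mul_comm (Gamma a)]
  filter_upwards [ae_restrict_mem measurableSet_Ioi] with x hx
  have : 0 < x := hx
  positivity

/-- Schwinger parametrization of a product of three powers with exponents summing to `4`. -/
lemma lintegral_schwinger_three {a b X Y Z : ℝ} (ha : 0 < a) (hb : 0 < b) (hab : a + b < 4)
    (hX : 0 < X) (hY : 0 < Y) (hZ : 0 < Z) :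
    ∫⁻ r in Ioi (0 : ℝ), ∫⁻ u in Ioi (0 : ℝ), ∫⁻ v in Ioi (0 : ℝ),
      ENNReal.ofReal (r ^ (3 : ℝ) * u ^ (a - 1) * v ^ (b - 1) *
        exp (-(r * (u * X + v * Y + Z)))) =
      ENNReal.ofReal (Gamma a * Gamma b * Gamma (4 - a - b) *
        (X ^ (-a) * Y ^ (-b) * Z ^ (-(4 - a - b)))) := by
  have hΓa := Gamma_pos_of_pos ha
  have hΓb := Gamma_pos_of_pos hb
  have hv : ∀ r ∈ Ioi (0 : ℝ), ∀ u ∈ Ioi (0 : ℝ), ∫⁻ v in Ioi (0 : ℝ),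
      ENNReal.ofReal (r ^ (3 : ℝ) * u ^ (a - 1) * v ^ (b - 1) *
        exp (-(r * (u * X + v * Y + Z)))) =
      ENNReal.ofReal (r ^ (3 : ℝ) * exp (-(r * Z)) * (Gamma b * (r * Y) ^ (-b)) *
        (u ^ (a - 1) * exp (-(r * X * u)))) := by
    intro r (hr : 0 < r) u (hu : 0 < u)
    calc _ = ∫⁻ v in Ioi (0 : ℝ), ENNReal.ofReal
          (r ^ (3 : ℝ) * u ^ (a - 1) * exp (-(r * (u * X + Z))) *
            (v ^ (b - 1) * exp (-(r * Y * v)))) := by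
          refine lintegral_congr fun v => congrArg _ ?_
          rw [show -(r * (u * X + v * Y + Z)) = -(r * (u * X + Z)) + -(r * Y * v) by ring, exp_add]
          ring
      _ = _ := by
          rw [lintegral_mul_rpow_mul_exp_neg_mul_Ioi (by positivity) hb (by positivity)]
          congr 1
          rw [show -(r * (u * X + Z)) = -(r * Z) + -(r * X * u) by ring, exp_add]
          ring
  have hu : ∀ r ∈ Ioi (0 : ℝ), ∫⁻ u in Ioi (0 : ℝ), ∫⁻ v in Ioi (0 : ℝ),
      ENNReal.ofReal (r ^ (3 : ℝ) * u ^ (a - 1) * v ^ (b - 1) *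
        exp (-(r * (u * X + v * Y + Z)))) =
      ENNReal.ofReal (Gamma a * Gamma b * X ^ (-a) * Y ^ (-b) *
        (r ^ ((4 - a - b) - 1) * exp (-(Z * r)))) := by
    intro r hr
    rw [setLIntegral_congr_fun measurableSet_Ioi (hv r hr)]
    have hr' : 0 < r := hr
    rw [lintegral_mul_rpow_mul_exp_neg_mul_Ioi (by positivity) ha (by positivity)]
    congr 1
    rw [mul_rpow hr'.le hY.le, mul_rpow hr'.le hX.le,
      show (4 - a - b) - 1 = 3 + -b + -a by ring, rpow_add hr', rpow_add hr', mul_comm Z r]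
    ring
  rw [setLIntegral_congr_fun measurableSet_Ioi hu,
    lintegral_mul_rpow_mul_exp_neg_mul_Ioi (by positivity) (by linarith) hZ]
  congr 1
  ring

/-- A Beta-type integral, expressed with Gamma functions. -/
lemma lintegral_rpow_mul_add_rpow_neg {a p A B : ℝ} (hp : 0 < p) (hpa : p < a)
    (hA : 0 < A) (hB : 0 < B) :
    ENNReal.ofReal (Gamma a) *
      ∫⁻ v in Ioi (0 : ℝ), ENNReal.ofReal (v ^ (p - 1) * (v * A + B) ^ (-a)) =
      ENNReal.ofReal (Gamma p * Gamma (a - p) * (A ^ (-p) * B ^ (-(a - p)))) := by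
  have ha : 0 < a := hp.trans hpa
  have hΓa := Gamma_pos_of_pos ha
  have hΓp := Gamma_pos_of_pos hp
  calc _ = ∫⁻ v in Ioi (0 : ℝ), ∫⁻ w in Ioi (0 : ℝ), ENNReal.ofReal
        (v ^ (p - 1) * (w ^ (a - 1) * exp (-((v * A + B) * w)))) := by
        rw [← lintegral_const_mul' _ _ ENNReal.ofReal_ne_top]
        refine setLIntegral_congr_fun measurableSet_Ioi fun v (hv : 0 < v) => ?_
        rw [lintegral_mul_rpow_mul_exp_neg_mul_Ioi (by positivity) ha (by positivity),
          ← ENNReal.ofReal_mul hΓa.le]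
        congr 1
        ring
    _ = ∫⁻ w in Ioi (0 : ℝ), ∫⁻ v in Ioi (0 : ℝ), ENNReal.ofReal
        (v ^ (p - 1) * (w ^ (a - 1) * exp (-((v * A + B) * w)))) :=
        lintegral_lintegral_swap (by fun_prop)
    _ = ∫⁻ w in Ioi (0 : ℝ), ENNReal.ofReal
        (Gamma p * A ^ (-p) * (w ^ ((a - p) - 1) * exp (-(B * w)))) := by
        refine setLIntegral_congr_fun measurableSet_Ioi fun w (hw : 0 < w) => ?_
        calc _ = ∫⁻ v in Ioi (0 : ℝ), ENNReal.ofReal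
              (w ^ (a - 1) * exp (-(B * w)) * (v ^ (p - 1) * exp (-(w * A * v)))) := by
              refine lintegral_congr fun v => congrArg _ ?_
              rw [show -((v * A + B) * w) = -(B * w) + -(w * A * v) by ring, exp_add]
              ring
          _ = _ := by
              rw [lintegral_mul_rpow_mul_exp_neg_mul_Ioi (by positivity) hp (by positivity)]
              congr 1
              rw [mul_rpow hw.le hA.le, show a - p - 1 = (a - 1) + -p by ring, rpow_add hw]
              ring
    _ = _ := by
        rw [lintegral_mul_rpow_mul_exp_neg_mul_Ioi (by positivity) (by linarith) hB]
        congr 1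
        ring

/-- The parametric integral dual to the triangle with squared side lengths `A`, `B`, `C`. -/
lemma lintegral_triangle {a b A B C : ℝ} (ha : 0 < a) (ha2 : a < 2) (hb2 : b < 2)
    (hab : 2 < a + b) (hA : 0 < A) (hB : 0 < B) (hC : 0 < C) :
    ∫⁻ u in Ioi (0 : ℝ), ∫⁻ v in Ioi (0 : ℝ), ∫⁻ r in Ioi (0 : ℝ),
      ENNReal.ofReal (u ^ (a - 1) * v ^ (b - 1) *
        (r ^ ((2 : ℝ) - 1) * exp (-((u * v * A + u * B + v * C) * r)))) =
      ENNReal.ofReal (Gamma (2 - a) * Gamma (a + b - 2) * Gamma (2 - b) *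
        (A ^ (-(a + b - 2)) * B ^ (-(2 - b)) * C ^ (-(2 - a)))) := by
  have hΓa := Gamma_pos_of_pos ha
  have hΓa' := Gamma_pos_of_pos (sub_pos.2 ha2)
  calc _ = ∫⁻ v in Ioi (0 : ℝ), ∫⁻ r in Ioi (0 : ℝ), ∫⁻ u in Ioi (0 : ℝ),
      ENNReal.ofReal (u ^ (a - 1) * v ^ (b - 1) *
        (r ^ ((2 : ℝ) - 1) * exp (-((u * v * A + u * B + v * C) * r)))) := by
        rw [lintegral_lintegral_swap (by fun_prop)]
        exact lintegral_congr fun v => lintegral_lintegral_swap (by fun_prop)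
    _ = ∫⁻ v in Ioi (0 : ℝ), ENNReal.ofReal (Gamma (2 - a) * C ^ (-(2 - a)) * Gamma a *
          (v ^ ((a + b - 2) - 1) * (v * A + B) ^ (-a))) := by
        refine setLIntegral_congr_fun measurableSet_Ioi fun v (hv : 0 < v) => ?_
        calc _ = ∫⁻ r in Ioi (0 : ℝ), ENNReal.ofReal (v ^ (b - 1) * Gamma a *
              (v * A + B) ^ (-a) * (r ^ ((2 - a) - 1) * exp (-(v * C * r)))) := by
              refine setLIntegral_congr_fun measurableSet_Ioi fun r (hr : 0 < r) => ?_
              calc _ = ∫⁻ u in Ioi (0 : ℝ), ENNReal.ofReal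
                    (v ^ (b - 1) * r ^ ((2 : ℝ) - 1) * exp (-(v * C * r)) *
                      (u ^ (a - 1) * exp (-(r * (v * A + B) * u)))) := by
                    refine lintegral_congr fun u => congrArg _ ?_
                    rw [show -((u * v * A + u * B + v * C) * r) =
                      -(v * C * r) + -(r * (v * A + B) * u) by ring, exp_add]
                    ring
                _ = _ := by
                    rw [lintegral_mul_rpow_mul_exp_neg_mul_Ioi (by positivity) ha (by positivity)]
                    congr 1
                    rw [mul_rpow hr.le (by positivity),
                      show 2 - a - 1 = ((2 : ℝ) - 1) + -a by ring, rpow_add hr]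
                    ring
          _ = _ := by
              rw [lintegral_mul_rpow_mul_exp_neg_mul_Ioi (by positivity) (by linarith)
                (by positivity)]
              congr 1
              rw [mul_rpow hv.le hC.le, show a + b - 2 - 1 = (b - 1) + -(2 - a) by ring,
                rpow_add hv]
              ring
    _ = _ := by
        simp_rw [fun v : ℝ => mul_assoc (Gamma (2 - a) * C ^ (-(2 - a))) (Gamma a)
          (v ^ ((a + b - 2) - 1) * (v * A + B) ^ (-a)),
          fun v : ℝ => ENNReal.ofReal_mul (q := Gamma a * (v ^ ((a + b - 2) - 1) *
            (v * A + B) ^ (-a))) (show 0 ≤ Gamma (2 - a) * C ^ (-(2 - a)) by positivity),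
          fun v : ℝ => ENNReal.ofReal_mul (q := v ^ ((a + b - 2) - 1) * (v * A + B) ^ (-a)) hΓa.le]
        rw [lintegral_const_mul' _ _ ENNReal.ofReal_ne_top,
          lintegral_const_mul' _ _ ENNReal.ofReal_ne_top,
          lintegral_rpow_mul_add_rpow_neg (by linarith) (by linarith) hA hB,
          ← ENNReal.ofReal_mul (by positivity), show a - (a + b - 2) = 2 - b by ring]
        congr 1
        ring

/-- Four-dimensional Euclidean space. -/
abbrev E4 := EuclideanSpace ℝ (Fin 4)

/-- The four-dimensional Gaussian integral. -/
lemma lintegral_exp_neg_mul_sq_norm {c : ℝ} (hc : 0 < c) :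
    ∫⁻ l : E4, ENNReal.ofReal (exp (-c * ‖l‖ ^ 2)) = ENNReal.ofReal ((π / c) ^ 2) := by
  have h := GaussianFourier.integral_rexp_neg_mul_sq_norm (V := E4) hc
  rw [finrank_euclideanSpace_fin, show ((4 : ℕ) : ℝ) / 2 = (2 : ℕ) by norm_num, rpow_natCast] at h
  have hint : Integrable (fun l : E4 => exp (-c * ‖l‖ ^ 2)) :=
    .of_integral_ne_zero (by rw [h]; positivity)
  rw [← ofReal_integral_eq_lintegral_ofReal hint (.of_forall fun _ => (exp_pos _).le), h]

/-- Completing the square for a weighted sum of three squared distances. -/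
lemma weighted_sq_norm_eq (p q l : E4) {u v : ℝ} (hS : u + v + 1 ≠ 0) :
    u * ‖l + p‖ ^ 2 + v * ‖l - q‖ ^ 2 + ‖l‖ ^ 2 =
      (u + v + 1) * ‖l + (u + v + 1)⁻¹ • (u • p - v • q)‖ ^ 2 +
        (u * v * ‖p + q‖ ^ 2 + u * ‖p‖ ^ 2 + v * ‖q‖ ^ 2) / (u + v + 1) := by
  simp only [norm_add_sq_real, norm_sub_sq_real, norm_smul, inner_sub_right,
    inner_smul_left, inner_smul_right, mul_pow, Real.norm_eq_abs, sq_abs, conj_trivial]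
  field_simp
  ring

/-- The Gaussian integral of a weighted sum of three squared distances. -/
lemma lintegral_exp_neg_weighted_sq_norm (p q : E4) {r u v : ℝ} (hr : 0 < r) (hu : 0 < u)
    (hv : 0 < v) :
    ∫⁻ l : E4, ENNReal.ofReal
        (exp (-(r * (u * ‖l + p‖ ^ 2 + v * ‖l - q‖ ^ 2 + ‖l‖ ^ 2)))) =
      ENNReal.ofReal ((π / (r * (u + v + 1))) ^ 2 *
        exp (-((u * v * ‖p + q‖ ^ 2 + u * ‖p‖ ^ 2 + v * ‖q‖ ^ 2) / (u + v + 1) * r))) := by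
  have hS : 0 < u + v + 1 := by positivity
  set D := (u * v * ‖p + q‖ ^ 2 + u * ‖p‖ ^ 2 + v * ‖q‖ ^ 2) / (u + v + 1) with hD
  calc _ = ∫⁻ l : E4, ENNReal.ofReal (exp (-(D * r))) * ENNReal.ofReal
        (exp (-(r * (u + v + 1)) * ‖l + (u + v + 1)⁻¹ • (u • p - v • q)‖ ^ 2)) := by
        refine lintegral_congr fun l => ?_
        rw [weighted_sq_norm_eq p q l hS.ne', ← hD, ← ENNReal.ofReal_mul (exp_pos _).le,
          ← exp_add]
        congr 2
        ring
    _ = _ := by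
        rw [lintegral_const_mul' _ _ ENNReal.ofReal_ne_top,
          lintegral_add_right_eq_self (fun l : E4 => ENNReal.ofReal
            (exp (-(r * (u + v + 1)) * ‖l‖ ^ 2))),
          lintegral_exp_neg_mul_sq_norm (by positivity), ← ENNReal.ofReal_mul (exp_pos _).le,
          mul_comm]

/-- The star-triangle relation in dimension four, with exponents `a`, `b`, `4 - a - b`. -/
lemma lintegral_star_triangle_s3 {a b : ℝ} (ha : 0 < a) (ha2 : a < 2) (hb : 0 < b) (hb2 : b < 2)
    (hab : 2 < a + b) {p q : E4} (hp : p ≠ 0) (hq : q ≠ 0) (hpq : p + q ≠ 0) :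
    ENNReal.ofReal (Gamma a * Gamma b * Gamma (4 - a - b)) * ∫⁻ l : E4, ENNReal.ofReal
        ((‖l + p‖ ^ 2) ^ (-a) * (‖l - q‖ ^ 2) ^ (-b) * (‖l‖ ^ 2) ^ (-(4 - a - b))) =
      ENNReal.ofReal (π ^ 2 * (Gamma (2 - a) * Gamma (a + b - 2) * Gamma (2 - b) *
        ((‖p + q‖ ^ 2) ^ (-(a + b - 2)) * (‖p‖ ^ 2) ^ (-(2 - b)) * (‖q‖ ^ 2) ^ (-(2 - a))))) := by
  have hΓa := Gamma_pos_of_pos ha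
  have hΓb := Gamma_pos_of_pos hb
  have hΓc := Gamma_pos_of_pos (show 0 < 4 - a - b by linarith)
  have hp' : 0 < ‖p‖ := norm_pos_iff.2 hp
  have hq' : 0 < ‖q‖ := norm_pos_iff.2 hq
  have hpq' : 0 < ‖p + q‖ := norm_pos_iff.2 hpq
  let F : E4 → ℝ → ℝ → ℝ → ENNReal := fun l r u v =>
    ENNReal.ofReal (r ^ (3 : ℝ) * u ^ (a - 1) * v ^ (b - 1) *
      exp (-(r * (u * ‖l + p‖ ^ 2 + v * ‖l - q‖ ^ 2 + ‖l‖ ^ 2))))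
  have hF : Measurable fun x : E4 × ℝ × ℝ × ℝ => F x.1 x.2.1 x.2.2.1 x.2.2.2 := by
    dsimp only [F]; fun_prop
  calc _ = ∫⁻ l : E4, ∫⁻ r in Ioi (0 : ℝ), ∫⁻ u in Ioi (0 : ℝ), ∫⁻ v in Ioi (0 : ℝ),
        F l r u v := by
        rw [← lintegral_const_mul' _ _ ENNReal.ofReal_ne_top]
        refine lintegral_congr_ae ?_
        filter_upwards [Measure.ae_ne volume (-p), Measure.ae_ne volume q,
          Measure.ae_ne volume (0 : E4)] with l h1 h2 h3
        have h1' : 0 < ‖l + p‖ := norm_pos_iff.2 fun h => h1 (eq_neg_of_add_eq_zero_left h)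
        have h2' : 0 < ‖l - q‖ := norm_pos_iff.2 (sub_ne_zero.2 h2)
        have h3' : 0 < ‖l‖ := norm_pos_iff.2 h3
        rw [← ENNReal.ofReal_mul (by positivity)]
        exact (lintegral_schwinger_three ha hb (by linarith) (by positivity) (by positivity)
          (by positivity)).symm
    _ = ∫⁻ u in Ioi (0 : ℝ), ∫⁻ v in Ioi (0 : ℝ), ∫⁻ r in Ioi (0 : ℝ), ∫⁻ l : E4,
        F l r u v := by
        rw [lintegral_lintegral_swap (by fun_prop)]
        simp_rw [fun r => lintegral_lintegral_swap (μ := (volume : Measure E4))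
          (ν := volume.restrict (Ioi (0 : ℝ)))
          (f := fun l u => ∫⁻ v in Ioi (0 : ℝ), F l r u v) (by fun_prop)]
        rw [lintegral_lintegral_swap (by fun_prop)]
        refine lintegral_congr fun u => ?_
        simp_rw [fun r => lintegral_lintegral_swap (μ := (volume : Measure E4))
          (ν := volume.restrict (Ioi (0 : ℝ))) (f := fun l v => F l r u v) (by fun_prop)]
        exact lintegral_lintegral_swap (by fun_prop)
    _ = ∫⁻ u in Ioi (0 : ℝ), ∫⁻ v in Ioi (0 : ℝ), ENNReal.ofReal (π ^ 2) *
        ∫⁻ r in Ioi (0 : ℝ), ENNReal.ofReal (u ^ (a - 1) * v ^ (b - 1) *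
        (r ^ ((2 : ℝ) - 1) *
          exp (-((u * v * ‖p + q‖ ^ 2 + u * ‖p‖ ^ 2 + v * ‖q‖ ^ 2) * r)))) := by
        refine setLIntegral_congr_fun measurableSet_Ioi fun u (hu : 0 < u) =>
          setLIntegral_congr_fun measurableSet_Ioi fun v (hv : 0 < v) => ?_
        calc _ = ∫⁻ r in Ioi (0 : ℝ), ENNReal.ofReal
              (u ^ (a - 1) * v ^ (b - 1) * (π / (u + v + 1)) ^ 2 * (r ^ ((2 : ℝ) - 1) *
              exp (-((u * v * ‖p + q‖ ^ 2 + u * ‖p‖ ^ 2 + v * ‖q‖ ^ 2) / (u + v + 1) * r)))) := by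
              refine setLIntegral_congr_fun measurableSet_Ioi fun r (hr : 0 < r) => ?_
              have hK : 0 ≤ r ^ (3 : ℝ) * u ^ (a - 1) * v ^ (b - 1) := by positivity
              simp only [F, ENNReal.ofReal_mul hK]
              rw [lintegral_const_mul' _ _ ENNReal.ofReal_ne_top,
                lintegral_exp_neg_weighted_sq_norm p q hr hu hv, ← ENNReal.ofReal_mul hK,
                show (3 : ℝ) = (3 : ℕ) by norm_num, rpow_natCast,
                show (2 : ℝ) - 1 = 1 by norm_num, rpow_one]
              congr 1
              field_simp
          _ = _ := by
              rw [lintegral_mul_rpow_mul_exp_neg_mul_Ioi (by positivity) two_pos (by positivity),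
                lintegral_mul_rpow_mul_exp_neg_mul_Ioi (by positivity) two_pos (by positivity),
                ← ENNReal.ofReal_mul (by positivity)]
              congr 1
              rw [show (-2 : ℝ) = (-2 : ℤ) by norm_num, rpow_intCast, rpow_intCast,
                zpow_neg, zpow_neg]
              norm_cast
              field_simp
    _ = _ := by
        simp_rw [lintegral_const_mul' _ _ (ENNReal.ofReal_ne_top (r := π ^ 2))]
        rw [lintegral_triangle ha ha2 hb2 hab (by positivity) (by positivity) (by positivity),
          ← ENNReal.ofReal_mul (by positivity)]

/-- Momentum-space star-triangle relation (the `D = 4` uniqueness relation applied in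
momentum space) used in the proof of the generalized Fourier identity. -/
theorem momentum_space_star_triangle
    (s t : ℝ) (hs : 0 < s) (ht : 0 < t) (hst : s + t < 2)
    (p₁ q : EuclideanSpace ℝ (Fin 4)) (hp₁ : p₁ ≠ 0) (hq : q ≠ 0) (hpq : p₁ + q ≠ 0)
    (p₂ : EuclideanSpace ℝ (Fin 4)) (hp₂ : p₂ = -p₁ - q) :
    Integrable (fun l : EuclideanSpace ℝ (Fin 4) =>
        ‖l + p₁‖ ^ (-2 * (s + t)) * ‖l - q‖ ^ (-2 * (2 - t)) * ‖l‖ ^ (-2 * (2 - s))) ∧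
    (∫ l : EuclideanSpace ℝ (Fin 4),
        ‖l + p₁‖ ^ (-2 * (s + t)) * ‖l - q‖ ^ (-2 * (2 - t)) * ‖l‖ ^ (-2 * (2 - s))) =
      Real.pi ^ 2 *
        (Real.Gamma s * Real.Gamma t * Real.Gamma (2 - s - t)) /
        (Real.Gamma (s + t) * Real.Gamma (2 - t) * Real.Gamma (2 - s)) *
        (‖q‖ ^ 2) ^ (-(2 - s - t)) * (‖p₁‖ ^ 2) ^ (-t) * (‖p₂‖ ^ 2) ^ (-s) := by
  have hΓ₁ := Gamma_pos_of_pos (show 0 < s + t by linarith)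
  have hΓ₂ := Gamma_pos_of_pos (show 0 < 2 - t by linarith)
  have hΓ₃ := Gamma_pos_of_pos (show 0 < 2 - s by linarith)
  have hΓ₄ := Gamma_pos_of_pos hs
  have hΓ₅ := Gamma_pos_of_pos ht
  have hΓ₆ := Gamma_pos_of_pos (show 0 < 2 - s - t by linarith)
  have hpow : ∀ (x : EuclideanSpace ℝ (Fin 4)) (c : ℝ), ‖x‖ ^ (-2 * c) = (‖x‖ ^ 2) ^ (-c) := by
    intro x c
    rw [← rpow_natCast_mul (norm_nonneg x)]
    congr 1
    push_cast
    ring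
  simp_rw [hpow]
  have hp₂' : ‖p₂‖ = ‖p₁ + q‖ := by rw [hp₂, ← norm_neg]; congr 1; abel
  have key := lintegral_star_triangle_s3 (a := s + t) (b := 2 - t) (by linarith) hst (by linarith)
    (by linarith) (by linarith) hp₁ hq hpq
  rw [show 4 - (s + t) - (2 - t) = 2 - s by ring, show s + t + (2 - t) - 2 = s by ring,
    show 2 - (s + t) = 2 - s - t by ring, show 2 - (2 - t) = t by ring, ← hp₂'] at key
  have hmeas : Measurable fun l : EuclideanSpace ℝ (Fin 4) =>
      (‖l + p₁‖ ^ 2) ^ (-(s + t)) * (‖l - q‖ ^ 2) ^ (-(2 - t)) * (‖l‖ ^ 2) ^ (-(2 - s)) := by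
    fun_prop
  have hnonneg : ∀ l : EuclideanSpace ℝ (Fin 4),
      0 ≤ (‖l + p₁‖ ^ 2) ^ (-(s + t)) * (‖l - q‖ ^ 2) ^ (-(2 - t)) * (‖l‖ ^ 2) ^ (-(2 - s)) :=
    fun l => by positivity
  constructor
  · rw [← lintegral_ofReal_ne_top_iff_integrable hmeas.aestronglyMeasurable (.of_forall hnonneg)]
    intro htop
    rw [htop, ENNReal.mul_top (by simpa using by positivity)] at key
    exact ENNReal.ofReal_ne_top key.symm
  · rw [integral_eq_lintegral_of_nonneg_ae (.of_forall hnonneg) hmeas.aestronglyMeasurable]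
    have := congrArg ENNReal.toReal key
    rw [ENNReal.toReal_mul, ENNReal.toReal_ofReal (by positivity),
      ENNReal.toReal_ofReal (by positivity)] at this
    field_simp
    linear_combination this
end
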